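/- arXiv:1711.00223 — 3 statements merged into one kernel-verified Lean document; each statement's English description precedes it below -/
import Mathlib

section
/- Let α ≥ 0 and let a, b : [0,∞) → ℝ be positive continuous functions. Suppose K, h : [0,∞) → ℝ are positive C² functions satisfying a(t)K''(t) + K'(t) ≥ b(t)K(t)^{1+α} for all t ≥ 0 and a(t)h''(t) + h'(t) ≤ b(t)h(t)^{1+α} for all t ≥ 0. If K(0) > h(0) and K'(0) ≥ h'(0), then K'(t) > h'(t) for all t > 0, and consequently K(t) > h(t) for all t ≥ 0. -/
open Real Set

/-- If `w'' > 0` at every zero of `w'` where `w > 0`, and `w > 0` on `[0, T)`, then `w' ≥ 0`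
at `0` implies `w' ≥ 0` on `[0, T]`. -/
theorem deriv_nonneg_of_pos_of_zero {w v u : ℝ → ℝ} {T : ℝ}
    (hv : ∀ t ∈ Ici (0 : ℝ), HasDerivWithinAt v (u t) (Ici 0) t)
    (hu : ∀ t ∈ Ici (0 : ℝ), 0 < w t → v t = 0 → 0 < u t)
    (hpos : ∀ t ∈ Ico 0 T, 0 < w t) (hv0 : 0 ≤ v 0) :
    ∀ t ∈ Icc 0 T, 0 ≤ v t := by
  intro t ht
  have hle : -v t ≤ 0 := by
    refine image_le_of_deriv_right_lt_deriv_boundary' (f := fun x => -v x)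
      (f' := fun x => -u x) (B := fun _ => 0) (B' := fun _ => 0) ?_ ?_ (by simpa using hv0)
      continuousOn_const (fun x _ => hasDerivWithinAt_const _ _ _) ?_ ht
    · exact fun x hx => ((hv x hx.1).continuousWithinAt.mono fun y hy => hy.1).neg
    · exact fun x hx => ((hv x hx.1).mono (Ici_subset_Ici.2 hx.1)).neg
    · intro x hx hx0
      have := hu x hx.1 (hpos x hx) (neg_eq_zero.1 hx0)
      linarith
  linarith

/-- A function on `[0, ∞)` with nonnegative derivative on `[0, T]` satisfies `w 0 ≤ w T`. -/
theorem le_of_hasDerivWithinAt_nonneg {w v : ℝ → ℝ} {T : ℝ} (hT : 0 ≤ T)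
    (hw : ∀ t ∈ Ici (0 : ℝ), HasDerivWithinAt w (v t) (Ici 0) t)
    (hv : ∀ t ∈ Icc 0 T, 0 ≤ v t) : w 0 ≤ w T := by
  refine monotoneOn_of_hasDerivWithinAt_nonneg (f' := v) (convex_Icc 0 T) ?_ ?_ ?_
    (left_mem_Icc.2 hT) (right_mem_Icc.2 hT) hT
  · exact fun x hx => (hw x hx.1).continuousWithinAt.mono fun y hy => hy.1
  · intro x hx
    have hx' := interior_subset hx
    exact (hw x hx'.1).mono fun y hy => (interior_subset hy).1
  · exact fun x hx => hv x (interior_subset hx)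

/-- If `w 0 > 0`, `w' 0 ≥ 0` and `w'' > 0` at every zero of `w'` where `w > 0`, then `w > 0` on
`[0, ∞)`. -/
theorem pos_of_deriv_zero_imp_pos {w v u : ℝ → ℝ}
    (hw : ∀ t ∈ Ici (0 : ℝ), HasDerivWithinAt w (v t) (Ici 0) t)
    (hv : ∀ t ∈ Ici (0 : ℝ), HasDerivWithinAt v (u t) (Ici 0) t)
    (hu : ∀ t ∈ Ici (0 : ℝ), 0 < w t → v t = 0 → 0 < u t)
    (hw0 : 0 < w 0) (hv0 : 0 ≤ v 0) : ∀ t ∈ Ici (0 : ℝ), 0 < w t := by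
  by_contra! hne
  set S : Set ℝ := Ici 0 ∩ w ⁻¹' Iic 0
  have hS : S.Nonempty := hne
  have hclosed : IsClosed S :=
    ContinuousOn.preimage_isClosed_of_isClosed (fun x hx => (hw x hx).continuousWithinAt)
      isClosed_Ici isClosed_Iic
  have hbdd : BddBelow S := ⟨0, fun x hx => hx.1⟩
  have hmem : sInf S ∈ S := hclosed.csInf_mem hS hbdd
  have hpos : ∀ t ∈ Ico 0 (sInf S), 0 < w t := fun t ht => by
    by_contra! hwt
    exact (csInf_le hbdd ⟨ht.1, hwt⟩).not_gt ht.2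
  have hle := le_of_hasDerivWithinAt_nonneg hmem.1 hw (deriv_nonneg_of_pos_of_zero hv hu hpos hv0)
  exact (hw0.trans_le hle).not_ge hmem.2

/-- Comparison lemma (Zhou–Han). Let `α ≥ 0` and let `a, b` be positive
continuous functions on `[0,∞)`. Suppose `K, h` are positive C² functions on `[0,∞)`
(with derivative data `K', K''` and `h', h''`) satisfying
`a(t)K''(t) + K'(t) ≥ b(t)K(t)^{1+α}` and `a(t)h''(t) + h'(t) ≤ b(t)h(t)^{1+α}`
for all `t ≥ 0`. If `K(0) > h(0)` and `K'(0) ≥ h'(0)`, then `K'(t) > h'(t)` for all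
`t > 0`, and consequently `K(t) > h(t)` for all `t ≥ 0`. -/
theorem comparison_lemma (α : ℝ) (hα : 0 ≤ α)
    (a b K h K' K'' h' h'' : ℝ → ℝ)
    (ha : ∀ t ∈ Set.Ici (0:ℝ), 0 < a t) (hb : ∀ t ∈ Set.Ici (0:ℝ), 0 < b t)
    (hacont : ContinuousOn a (Set.Ici 0)) (hbcont : ContinuousOn b (Set.Ici 0))
    (hKpos : ∀ t ∈ Set.Ici (0:ℝ), 0 < K t) (hhpos : ∀ t ∈ Set.Ici (0:ℝ), 0 < h t)
    (hK' : ∀ t ∈ Set.Ici (0:ℝ), HasDerivWithinAt K (K' t) (Set.Ici 0) t)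
    (hK'' : ∀ t ∈ Set.Ici (0:ℝ), HasDerivWithinAt K' (K'' t) (Set.Ici 0) t)
    (hK''cont : ContinuousOn K'' (Set.Ici 0))
    (hh' : ∀ t ∈ Set.Ici (0:ℝ), HasDerivWithinAt h (h' t) (Set.Ici 0) t)
    (hh'' : ∀ t ∈ Set.Ici (0:ℝ), HasDerivWithinAt h' (h'' t) (Set.Ici 0) t)
    (hh''cont : ContinuousOn h'' (Set.Ici 0))
    (hKineq : ∀ t ∈ Set.Ici (0:ℝ), b t * K t ^ (1 + α) ≤ a t * K'' t + K' t)
    (hhineq : ∀ t ∈ Set.Ici (0:ℝ), a t * h'' t + h' t ≤ b t * h t ^ (1 + α))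
    (hinit : h 0 < K 0) (hinit' : h' 0 ≤ K' 0) :
    (∀ t : ℝ, 0 < t → h' t < K' t) ∧ ∀ t ∈ Set.Ici (0:ℝ), h t < K t := by
  have hw : ∀ t ∈ Ici (0 : ℝ), HasDerivWithinAt (fun x => K x - h x) (K' t - h' t) (Ici 0) t :=
    fun t ht => (hK' t ht).sub (hh' t ht)
  have hv : ∀ t ∈ Ici (0 : ℝ),
      HasDerivWithinAt (fun x => K' x - h' x) (K'' t - h'' t) (Ici 0) t :=
    fun t ht => (hK'' t ht).sub (hh'' t ht)
  have hu : ∀ t ∈ Ici (0 : ℝ), 0 < K t - h t → K' t - h' t = 0 → 0 < K'' t - h'' t := by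
    intro t ht hpos hzero
    have hpow : h t ^ (1 + α) < K t ^ (1 + α) :=
      Real.rpow_lt_rpow (hhpos t ht).le (by linarith) (by linarith)
    have hmul := mul_lt_mul_of_pos_left hpow (hb t ht)
    have hK := hKineq t ht
    have hh := hhineq t ht
    refine pos_of_mul_pos_right (a := a t) ?_ (ha t ht).le
    rw [mul_sub]
    linarith
  have hpos := pos_of_deriv_zero_imp_pos hw hv hu (by linarith) (by linarith)
  have hnonneg : ∀ t ∈ Ici (0 : ℝ), 0 ≤ K' t - h' t := fun t ht =>
    deriv_nonneg_of_pos_of_zero hv hu (fun s hs => hpos s hs.1) (by linarith) t ⟨ht, le_rfl⟩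
  refine ⟨fun t ht => ?_, fun t ht => sub_pos.1 (hpos t ht)⟩
  refine sub_pos.1 ((hnonneg t ht.le).lt_of_ne' fun hzero => ?_)
  have hmin : IsLocalMin (fun x => K' x - h' x) t := by
    filter_upwards [Ici_mem_nhds ht] with s hs
    simpa only [hzero] using hnonneg s hs
  have hderiv := hmin.hasDerivAt_eq_zero ((hv t ht.le).hasDerivAt (Ici_mem_nhds ht))
  exact (hu t ht.le (hpos t ht.le) hzero).ne' hderiv
end

section
/- Let μ ∈ ℝ and η > 0, and define λ_η(t) = (η(t+1))^{(μ+1)/2} K_{(μ−1)/2}(η(t+1)) for t ≥ 0. Then λ_η satisfies the ordinary differential equation (1+t)² λ_η''(t) − μ(1+t) λ_η'(t) + (μ − η²(1+t)²) λ_η(t) = 0 for all t ≥ 0. -/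
open MeasureTheory Real Set

/-- The modified Bessel function of the second kind,
`K_ν(t) = ∫₀^∞ exp(−t cosh ζ) cosh(νζ) dζ`. -/
noncomputable def besselK (ν t : ℝ) : ℝ :=
  ∫ ζ in Set.Ioi (0:ℝ), Real.exp (-t * Real.cosh ζ) * Real.cosh (ν * ζ)

/-- `λ_η(t) = (η(t+1))^{(μ+1)/2} K_{(μ−1)/2}(η(t+1))`. -/
noncomputable def lamEta (μ η t : ℝ) : ℝ :=
  (η * (t + 1)) ^ ((μ + 1) / 2) * besselK ((μ - 1) / 2) (η * (t + 1))

/-- The integrand of the `k`-th `t`-derivative of `besselK`, up to sign. -/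
noncomputable def besselKIntegrand (ν : ℝ) (k : ℕ) (t ζ : ℝ) : ℝ :=
  Real.exp (-t * Real.cosh ζ) * Real.cosh ζ ^ k * Real.cosh (ν * ζ)

/-- The `k`-th `t`-derivative of `besselK`, up to sign. -/
noncomputable def besselKMoment (ν : ℝ) (k : ℕ) (t : ℝ) : ℝ :=
  ∫ ζ in Set.Ioi (0 : ℝ), besselKIntegrand ν k t ζ

lemma besselKIntegrand_nonneg (ν : ℝ) (k : ℕ) (t ζ : ℝ) : 0 ≤ besselKIntegrand ν k t ζ := by
  have := Real.cosh_pos ζ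
  have := Real.cosh_pos (ν * ζ)
  unfold besselKIntegrand
  positivity

lemma continuous_besselKIntegrand (ν : ℝ) (k : ℕ) (t : ℝ) :
    Continuous (besselKIntegrand ν k t) := by
  unfold besselKIntegrand
  fun_prop

lemma cosh_le_exp_abs (x : ℝ) : Real.cosh x ≤ Real.exp |x| := by
  rw [← Real.cosh_abs, Real.cosh_eq]
  have : Real.exp (-|x|) ≤ Real.exp |x| := Real.exp_le_exp.2 (by linarith [abs_nonneg x])
  linarith

lemma abs_sinh_le_cosh (x : ℝ) : |Real.sinh x| ≤ Real.cosh x :=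
  abs_le_of_sq_le_sq (by linarith [Real.cosh_sq x]) (Real.cosh_pos x).le

lemma sq_div_four_le_cosh {x : ℝ} (hx : 0 ≤ x) : x ^ 2 / 4 ≤ Real.cosh x := by
  rw [Real.cosh_eq]
  linarith [Real.quadratic_le_exp_of_nonneg hx, Real.exp_pos (-x)]

lemma besselKIntegrand_le (ν : ℝ) (k : ℕ) {t ζ : ℝ} (ht : 0 < t) (hζ : 0 ≤ ζ) :
    besselKIntegrand ν k t ζ ≤
      Real.exp ((k + |ν| + 1) ^ 2 / t) * Real.exp (-1 * ζ) := by
  have h1 : Real.cosh ζ ^ k ≤ Real.exp (k * ζ) := by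
    rw [Real.exp_nat_mul]
    gcongr
    simpa [abs_of_nonneg hζ] using cosh_le_exp_abs ζ
  have h2 : Real.cosh (ν * ζ) ≤ Real.exp (|ν| * ζ) := by
    simpa [abs_mul, abs_of_nonneg hζ] using cosh_le_exp_abs (ν * ζ)
  have h3 : (k + |ν| + 1) * ζ ≤ t * Real.cosh ζ + (k + |ν| + 1) ^ 2 / t := by
    have h4 : (k + |ν| + 1) * ζ ≤ t * (ζ ^ 2 / 4) + (k + |ν| + 1) ^ 2 / t := by
      have h5 : t * (ζ ^ 2 / 4) + (k + |ν| + 1) ^ 2 / t - (k + |ν| + 1) * ζ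
          = t * (ζ / 2 - (k + |ν| + 1) / t) ^ 2 := by
        field_simp
        ring
      have : 0 ≤ t * (ζ / 2 - (k + |ν| + 1) / t) ^ 2 := by positivity
      linarith
    linarith [mul_le_mul_of_nonneg_left (sq_div_four_le_cosh hζ) ht.le]
  calc besselKIntegrand ν k t ζ
      ≤ Real.exp (-t * Real.cosh ζ) * Real.exp (k * ζ) * Real.exp (|ν| * ζ) := by
        unfold besselKIntegrand
        have := (Real.cosh_pos (ν * ζ)).le
        gcongr
    _ ≤ _ := by
        rw [← Real.exp_add, ← Real.exp_add, ← Real.exp_add]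
        exact Real.exp_le_exp.2 (by linarith)

lemma integrableOn_besselKIntegrand (ν : ℝ) (k : ℕ) {t : ℝ} (ht : 0 < t) :
    IntegrableOn (besselKIntegrand ν k t) (Set.Ioi 0) := by
  refine Integrable.mono' ((exp_neg_integrableOn_Ioi 0 one_pos).const_mul
    (Real.exp ((k + |ν| + 1) ^ 2 / t))) (continuous_besselKIntegrand ν k t).aestronglyMeasurable ?_
  filter_upwards [ae_restrict_mem measurableSet_Ioi] with ζ hζ
  rw [Real.norm_of_nonneg (besselKIntegrand_nonneg ν k t ζ)]
  exact besselKIntegrand_le ν k ht (le_of_lt hζ)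

lemma tendsto_besselKIntegrand_atTop (ν : ℝ) (k : ℕ) {t : ℝ} (ht : 0 < t) :
    Filter.Tendsto (besselKIntegrand ν k t) Filter.atTop (nhds 0) := by
  have h : Filter.Tendsto (fun ζ : ℝ => Real.exp ((k + |ν| + 1) ^ 2 / t) * Real.exp (-1 * ζ))
      Filter.atTop (nhds 0) := by
    simpa using Real.tendsto_exp_neg_atTop_nhds_zero.const_mul (Real.exp ((k + |ν| + 1) ^ 2 / t))
  refine squeeze_zero' (.of_forall (besselKIntegrand_nonneg ν k t)) ?_ h
  filter_upwards [Filter.eventually_ge_atTop 0] with ζ hζ using besselKIntegrand_le ν k ht hζ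

lemma hasDerivAt_besselKMoment (ν : ℝ) (k : ℕ) {t : ℝ} (ht : 0 < t) :
    HasDerivAt (besselKMoment ν k) (-besselKMoment ν (k + 1) t) t := by
  have h := hasDerivAt_integral_of_dominated_loc_of_deriv_le
    (μ := volume.restrict (Set.Ioi (0 : ℝ))) (F := besselKIntegrand ν k)
    (F' := fun s ζ => -besselKIntegrand ν (k + 1) s ζ)
    (bound := besselKIntegrand ν (k + 1) (t / 2)) (Ioi_mem_nhds (half_lt_self ht))
    (.of_forall fun s => (continuous_besselKIntegrand ν k s).aestronglyMeasurable)
    (integrableOn_besselKIntegrand ν k ht)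
    (continuous_besselKIntegrand ν (k + 1) t).neg.aestronglyMeasurable
    (.of_forall fun ζ s hs => ?_)
    (integrableOn_besselKIntegrand ν (k + 1) (half_pos ht))
    (.of_forall fun ζ s _ => ?_)
  · rw [integral_neg] at h
    exact h.2
  · rw [norm_neg, Real.norm_of_nonneg (besselKIntegrand_nonneg ν (k + 1) s ζ)]
    unfold besselKIntegrand
    have := (Real.cosh_pos ζ).le
    have := (Real.cosh_pos (ν * ζ)).le
    have : t / 2 ≤ s := le_of_lt hs
    gcongr
  · unfold besselKIntegrand
    have h1 : HasDerivAt (fun s : ℝ => -s * Real.cosh ζ) (-1 * Real.cosh ζ) s :=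
      (hasDerivAt_neg s).mul_const _
    refine ((h1.exp.mul_const (Real.cosh ζ ^ k)).mul_const (Real.cosh (ν * ζ))).congr_deriv ?_
    ring

/-- The modified Bessel equation, in terms of the moments. -/
lemma besselKMoment_ode (ν : ℝ) {t : ℝ} (ht : 0 < t) :
    t ^ 2 * besselKMoment ν 2 t - t * besselKMoment ν 1 t
      - (t ^ 2 + ν ^ 2) * besselKMoment ν 0 t = 0 := by
  have i (k : ℕ) := integrableOn_besselKIntegrand ν k ht
  have i2 := (i 2).const_mul (t ^ 2)
  have i1 := (i 1).const_mul t
  have i0 := (i 0).const_mul (t ^ 2 + ν ^ 2)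
  let F : ℝ → ℝ := fun ζ => -(Real.exp (-t * Real.cosh ζ) *
    (t * (Real.sinh ζ * Real.cosh (ν * ζ)) + ν * Real.sinh (ν * ζ)))
  have hF (ζ : ℝ) : HasDerivAt F (t ^ 2 * besselKIntegrand ν 2 t ζ - t * besselKIntegrand ν 1 t ζ
      - (t ^ 2 + ν ^ 2) * besselKIntegrand ν 0 t ζ) ζ := by
    have e := ((Real.hasDerivAt_cosh ζ).const_mul (-t)).exp
    have l : HasDerivAt (fun ζ : ℝ => ν * ζ) ν ζ := by
      simpa using (hasDerivAt_id ζ).const_mul ν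
    refine ((e.fun_mul ((((Real.hasDerivAt_sinh ζ).fun_mul l.cosh).const_mul t).fun_add
      (l.sinh.const_mul ν))).fun_neg).congr_deriv ?_
    simp only [besselKIntegrand]
    linear_combination (t ^ 2 * Real.exp (-t * Real.cosh ζ) * Real.cosh (ν * ζ)) *
      (Real.sinh_sq ζ)
  have hlim : Filter.Tendsto F Filter.atTop (nhds 0) := by
    have hb : Filter.Tendsto
        (fun ζ => t * besselKIntegrand ν 1 t ζ + |ν| * besselKIntegrand ν 0 t ζ)
        Filter.atTop (nhds 0) := by
      simpa using ((tendsto_besselKIntegrand_atTop ν 1 ht).const_mul t).add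
        ((tendsto_besselKIntegrand_atTop ν 0 ht).const_mul |ν|)
    refine squeeze_zero_norm (fun ζ => ?_) hb
    have h1 := abs_sinh_le_cosh ζ
    have h2 := abs_sinh_le_cosh (ν * ζ)
    have hc := (Real.cosh_pos (ν * ζ)).le
    calc ‖F ζ‖ ≤ Real.exp (-t * Real.cosh ζ) *
          (t * (|Real.sinh ζ| * Real.cosh (ν * ζ)) + |ν| * |Real.sinh (ν * ζ)|) := by
          simp only [F, norm_neg, Real.norm_eq_abs, abs_mul, Real.abs_exp]
          gcongr
          refine (abs_add_le _ _).trans_eq ?_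
          simp only [abs_mul, abs_of_pos ht, abs_of_nonneg hc]
      _ ≤ Real.exp (-t * Real.cosh ζ) *
          (t * (Real.cosh ζ * Real.cosh (ν * ζ)) + |ν| * Real.cosh (ν * ζ)) := by gcongr
      _ = _ := by
          unfold besselKIntegrand
          ring
  have i21 : IntegrableOn
      (fun ζ => t ^ 2 * besselKIntegrand ν 2 t ζ - t * besselKIntegrand ν 1 t ζ) (Set.Ioi 0) :=
    i2.sub i1
  have h := integral_Ioi_of_hasDerivAt_of_tendsto' (a := 0) (fun ζ _ => hF ζ)
    (i21.sub i0) hlim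
  rw [integral_sub i21 i0, integral_sub i2 i1] at h
  simpa [integral_const_mul, besselKMoment, F] using h

lemma besselK_eq_besselKMoment (ν : ℝ) : besselK ν = besselKMoment ν 0 := by
  ext t
  simp [besselK, besselKMoment, besselKIntegrand]

/-- For `μ ∈ ℝ`, `η > 0`, the function
`λ_η(t) = (η(t+1))^{(μ+1)/2} K_{(μ−1)/2}(η(t+1))` satisfies the ODE
`(1+t)² λ_η''(t) − μ(1+t) λ_η'(t) + (μ − η²(1+t)²) λ_η(t) = 0` for all `t ≥ 0`. -/
theorem lamEta_ode (μ η : ℝ) (hη : 0 < η) (t : ℝ) (ht : 0 ≤ t) :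
    (1 + t) ^ 2 * deriv (deriv (lamEta μ η)) t - μ * (1 + t) * deriv (lamEta μ η) t
      + (μ - η ^ 2 * (1 + t) ^ 2) * lamEta μ η t = 0 := by
  set a := (μ + 1) / 2 with ha
  set ν := (μ - 1) / 2 with hν
  have hlam : lamEta μ η = fun s => (η * (s + 1)) ^ a * besselKMoment ν 0 (η * (s + 1)) := by
    ext s
    rw [lamEta, besselK_eq_besselKMoment]
  have hlin (s : ℝ) : HasDerivAt (fun s => η * (s + 1)) η s := by
    simpa using ((hasDerivAt_id s).add_const 1).const_mul η
  have hterm (b : ℝ) (k : ℕ) {s : ℝ} (hs : -1 < s) :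
      HasDerivAt (fun s => (η * (s + 1)) ^ b * besselKMoment ν k (η * (s + 1)))
        (η * b * ((η * (s + 1)) ^ (b - 1) * besselKMoment ν k (η * (s + 1)))
          - η * ((η * (s + 1)) ^ b * besselKMoment ν (k + 1) (η * (s + 1)))) s := by
    have hpos : 0 < η * (s + 1) := mul_pos hη (by linarith)
    refine (((hlin s).rpow_const (p := b) (Or.inl hpos.ne')).fun_mul
      ((hasDerivAt_besselKMoment ν k hpos).comp s (hlin s))).congr_deriv ?_
    simp only [Function.comp_apply]
    ring
  have ht1 : -1 < t := by linarith
  have hd1 : deriv (lamEta μ η) =ᶠ[nhds t] fun s =>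
      η * a * ((η * (s + 1)) ^ (a - 1) * besselKMoment ν 0 (η * (s + 1)))
        - η * ((η * (s + 1)) ^ a * besselKMoment ν 1 (η * (s + 1))) := by
    filter_upwards [Ioi_mem_nhds ht1] with s hs
    rw [hlam]
    exact (hterm a 0 hs).deriv
  rw [hd1.deriv_eq, hd1.eq_of_nhds, hlam,
    (((hterm (a - 1) 0 ht1).const_mul (η * a)).fun_sub ((hterm a 1 ht1).const_mul η)).deriv]
  beta_reduce
  have hpos : 0 < η * (t + 1) := mul_pos hη (by linarith)
  have hode := besselKMoment_ode ν hpos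
  have hb1 : (η * (t + 1)) ^ (a - 1) = (η * (t + 1)) ^ (a - 1 - 1) * (η * (t + 1)) := by
    rw [← Real.rpow_add_one hpos.ne']
    ring_nf
  have hb0 : (η * (t + 1)) ^ a = (η * (t + 1)) ^ (a - 1 - 1) * (η * (t + 1)) ^ 2 := by
    rw [← Real.rpow_add_natCast hpos.ne']
    push_cast
    ring_nf
  rw [hb0, hb1]
  have hμ : μ = 2 * a - 1 := by rw [ha]; ring
  have hνa : ν = a - 1 := by rw [hν, ha]; ring
  rw [hνa] at hode ⊢
  rw [hμ]
  simp only [zero_add, Nat.reduceAdd]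
  linear_combination (η * (t + 1)) ^ (a - 1 - 1) * (η * (t + 1)) ^ 2 * hode
end

section
/- Let n ≥ 2 be an integer, μ > 0 a real number, p = p_S(n+μ), and q = (n−μ−1)/2 − 1/p. If q > −min(μ,1) and q > −μ/2, then μ < μ_* := (n²+n+2)/(n+2). -/
open Real

/-- The Strauss exponent `p_S(d) = (d+1+√(d²+10d−7))/(2(d−1))`, the positive root of
`γ(p,d) := 2+(d+1)p−(d−1)p² = 0` for `d > 1`. -/
noncomputable def pS (d : ℝ) : ℝ :=
  (d + 1 + Real.sqrt (d ^ 2 + 10 * d - 7)) / (2 * (d - 1))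

theorem pS_pos {d : ℝ} (hd : 1 < d) : 0 < pS d := by
  have h := Real.sqrt_nonneg (d ^ 2 + 10 * d - 7)
  unfold pS
  apply div_pos <;> linarith

theorem pS_root {d : ℝ} (hd : 1 < d) :
    2 + (d + 1) * pS d - (d - 1) * pS d ^ 2 = 0 := by
  have hs := Real.sq_sqrt (show 0 ≤ d ^ 2 + 10 * d - 7 by nlinarith)
  have hd' : d - 1 ≠ 0 := by linarith
  unfold pS
  generalize √(d ^ 2 + 10 * d - 7) = s at hs ⊢
  field_simp
  linear_combination -hs

/-- The reciprocal of the Strauss exponent is a root of the reversed polynomial. -/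
theorem inv_pS_root {d : ℝ} (hd : 1 < d) :
    2 * (1 / pS d) ^ 2 + (d + 1) * (1 / pS d) - (d - 1) = 0 := by
  have hp := (pS_pos hd).ne'
  have h := pS_root hd
  field_simp
  linear_combination h

/-- For an integer `n ≥ 2`, `μ > 0`, `p = p_S(n+μ)` and
`q = (n−μ−1)/2 − 1/p`, if `q > −min(μ,1)` and `q > −μ/2` then
`μ < μ_* := (n²+n+2)/(n+2)`. -/
theorem mu_lt_mu_star (n : ℕ) (hn : 2 ≤ n) (μ : ℝ) (hμ : 0 < μ)
    (hq1 : -min μ 1 < ((n : ℝ) - μ - 1) / 2 - 1 / pS ((n : ℝ) + μ))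
    (hq2 : -(μ / 2) < ((n : ℝ) - μ - 1) / 2 - 1 / pS ((n : ℝ) + μ)) :
    μ < ((n : ℝ) ^ 2 + (n : ℝ) + 2) / ((n : ℝ) + 2) := by
  have hn' : (2 : ℝ) ≤ n := by exact_mod_cast hn
  have hd : 1 < (n : ℝ) + μ := by linarith
  have hx := one_div_pos.mpr (pS_pos hd)
  have hroot := inv_pS_root hd
  have hmin := min_le_right μ 1
  set x := 1 / pS ((n : ℝ) + μ)
  have hxa : x < ((n : ℝ) + 1 - μ) / 2 := by linarith
  have hsq : x ^ 2 < (((n : ℝ) + 1 - μ) / 2) ^ 2 := by gcongr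
  have hlin : ((n : ℝ) + μ + 1) * x < ((n : ℝ) + μ + 1) * (((n : ℝ) + 1 - μ) / 2) := by
    gcongr
  rw [lt_div_iff₀ (by linarith)]
  linarith
end
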